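/- Let D ~ N(0, I_k) and let ζ_{k,d} be distributed as D conditioned on D^T D ≤ d for some d > 0. Then ζ_{k,d} is more peaked than D, i.e., for every symmetric convex set K ⊆ R^k, P(ζ_{k,d} ∈ K) ≥ P(D ∈ K). -/

import Mathlib

open MeasureTheory ProbabilityTheory Matrix

/-- The standard Gaussian measure on `ℝ^k`. -/
noncomputable def stdGaussian (k : ℕ) : Measure (Fin k → ℝ) :=
  Measure.pi fun _ => gaussianReal 0 1

/-- The truncated Gaussian `ζ_{k,d}`: the law of a standard Gaussian `D` in `ℝ^k`
conditioned on `Dᵀ D ≤ d`. -/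
noncomputable def truncGaussian (k : ℕ) (d : ℝ) : Measure (Fin k → ℝ) :=
  (stdGaussian k)[|{x | ∑ i, (x i) ^ 2 ≤ d}]

theorem trunc_polar {E : Type*} [NormedAddCommGroup E] [NormedSpace ℝ E] [MeasurableSpace E]
    [BorelSpace E] [FiniteDimensional ℝ E] [Nontrivial E] (μ : Measure E) [μ.IsAddHaarMeasure]
    (c : ℝ → ENNReal) (hc : Measurable c) (S : Set E) (hS : MeasurableSet S) :
    Measurable (fun θ : Metric.sphere (0:E) 1 => ((Measure.volumeIoiPow (Module.finrank ℝ E - 1)).withDensity (fun r => c r.1))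
        {r : Set.Ioi (0:ℝ) | r.1 • θ.1 ∈ S}) ∧
    (μ.withDensity (fun x => c ‖x‖)) S =
      ∫⁻ θ, ((Measure.volumeIoiPow (Module.finrank ℝ E - 1)).withDensity (fun r => c r.1))
        {r : Set.Ioi (0:ℝ) | r.1 • θ.1 ∈ S} ∂μ.toSphere := by
  set ρ := Measure.volumeIoiPow (Module.finrank ℝ E - 1)
  have hc1 : Measurable (fun r : Set.Ioi (0:ℝ) => c r.1) := hc.comp measurable_subtype_coe
  have hM : MeasurableSet {p : Metric.sphere (0:E) 1 × Set.Ioi (0:ℝ) | p.2.1 • p.1.1 ∈ S} := by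
    refine (Measurable.smul (by fun_prop) (by fun_prop)) hS
  constructor
  · exact measurable_measure_prodMk_left hM
  refine Eq.trans ?_ (Measure.prod_apply hM)
  rw [prod_withDensity_right hc1, withDensity_apply _ hM, withDensity_apply _ hS,
    ← lintegral_indicator hS, ← lintegral_indicator hM]
  rw [← μ.measurePreserving_homeomorphUnitSphereProd.lintegral_comp_emb (Homeomorph.measurableEmbedding _)]
  rw [← restrict_compl_singleton (μ := μ) 0, ← lintegral_subtype_comap (measurableSet_singleton _).compl]
  rw [restrict_compl_singleton (μ := μ) 0]
  refine lintegral_congr fun x => ?_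
  have hx : x.1 ≠ 0 := x.2
  have hxx : ((homeomorphUnitSphereProd E) x).2.1 • ((homeomorphUnitSphereProd E) x).1.1 = x.1 := by
    rw [← homeomorphUnitSphereProd_symm_apply_coe, Homeomorph.symm_apply_apply]
  have hiff : (homeomorphUnitSphereProd E) x ∈
      {p : Metric.sphere (0:E) 1 × Set.Ioi (0:ℝ) | p.2.1 • p.1.1 ∈ S} ↔ x.1 ∈ S := by
    rw [← hxx]; rfl
  by_cases h : x.1 ∈ S
  · rw [Set.indicator_of_mem h, Set.indicator_of_mem (hiff.2 h)]
    simp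
  · rw [Set.indicator_of_notMem h, Set.indicator_of_notMem (fun h' => h (hiff.1 h'))]

theorem trunc_core {E : Type*} [NormedAddCommGroup E] [NormedSpace ℝ E] [MeasurableSpace E]
    [BorelSpace E] [FiniteDimensional ℝ E] [Nontrivial E] (μ : Measure E) [μ.IsAddHaarMeasure]
    (c : ℝ → ENNReal) (hc : Measurable c) [IsProbabilityMeasure (μ.withDensity (fun x => c ‖x‖))]
    (S : Set E) (hS : MeasurableSet S)
    (hstar : ∀ x ∈ S, ∀ t : ℝ, 0 ≤ t → t ≤ 1 → t • x ∈ S) (R : ℝ) :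
    (μ.withDensity (fun x => c ‖x‖)) (Metric.closedBall 0 R) * (μ.withDensity (fun x => c ‖x‖)) S
      ≤ (μ.withDensity (fun x => c ‖x‖)) (Metric.closedBall 0 R ∩ S) := by
  set γ := μ.withDensity (fun x => c ‖x‖) with hγ
  set ν := (Measure.volumeIoiPow (Module.finrank ℝ E - 1)).withDensity (fun r => c r.1) with hν
  have hB : MeasurableSet (Metric.closedBall (0:E) R) := Metric.isClosed_closedBall.measurableSet
  obtain ⟨m1, e1⟩ := trunc_polar μ c hc S hS
  obtain ⟨m2, e2⟩ := trunc_polar μ c hc _ (hB.inter hS)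
  obtain ⟨-, e3⟩ := trunc_polar μ c hc _ hB
  obtain ⟨-, e4⟩ := trunc_polar μ c hc _ MeasurableSet.univ
  rw [← hγ, ← hν] at e1 e2 e3 e4
  have hb : ∀ θ : Metric.sphere (0:E) 1, {r : Set.Ioi (0:ℝ) | r.1 • θ.1 ∈ Metric.closedBall (0:E) R}
      = {r | r.1 ≤ R} := by
    intro θ
    ext r
    have := r.2.out
    simp [norm_smul, abs_of_pos this]
  simp only [hb, lintegral_const] at e3
  simp only [Set.mem_univ, Set.ofPred_true, lintegral_const, measure_univ] at e4
  have key : ∀ θ : Metric.sphere (0:E) 1, ν {r | r.1 ≤ R} * ν {r : Set.Ioi (0:ℝ) | r.1 • θ.1 ∈ S} ≤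
      ν Set.univ * ν {r : Set.Ioi (0:ℝ) | r.1 • θ.1 ∈ Metric.closedBall (0:E) R ∩ S} := by
    intro θ
    have hi : {r : Set.Ioi (0:ℝ) | r.1 • θ.1 ∈ Metric.closedBall (0:E) R ∩ S} =
      {r | r.1 ≤ R} ∩ {r : Set.Ioi (0:ℝ) | r.1 • θ.1 ∈ S} := by
      rw [← hb θ]; rfl
    rw [hi]
    by_cases h : {r : Set.Ioi (0:ℝ) | r.1 • θ.1 ∈ S} ⊆ {r | r.1 ≤ R}
    · rw [Set.inter_eq_right.2 h]
      gcongr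
      exact Set.subset_univ _
    · rw [Set.not_subset] at h
      obtain ⟨r, hr, hr'⟩ := h
      rw [Set.inter_eq_left.2, mul_comm]
      · gcongr
        exact Set.subset_univ _
      intro s hs
      have h0 : 0 < r.1 := r.2
      have h1 : 0 < s.1 := s.2
      simp only [Set.mem_ofPred_eq, not_le] at hr hr' hs ⊢
      have := hstar _ hr (s.1 / r.1) (by positivity) ((div_le_one h0).2 (by linarith))
      rwa [smul_smul, div_mul_cancel₀ _ h0.ne'] at this
  have h := lintegral_mono (μ := μ.toSphere) key
  rw [lintegral_const_mul _ m1, lintegral_const_mul _ m2, ← e1, ← e2] at h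
  calc γ (Metric.closedBall 0 R) * γ S = μ.toSphere Set.univ * (ν {r | r.1 ≤ R} * γ S) := by
        rw [e3]; ring
    _ ≤ μ.toSphere Set.univ * (ν Set.univ * γ (Metric.closedBall 0 R ∩ S)) := by gcongr
    _ = (ν Set.univ * μ.toSphere Set.univ) * γ (Metric.closedBall 0 R ∩ S) := by ring
    _ = _ := by rw [← e4, one_mul]

theorem trunc_pi_density (k : ℕ) : Measure.pi (fun _ : Fin k => gaussianReal 0 1) =
    (volume : Measure (Fin k → ℝ)).withDensity
      (fun x => ENNReal.ofReal (∏ i, gaussianPDFReal 0 1 (x i))) := by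
  refine Measure.pi_eq fun s hs => ?_
  have hpi : MeasurableSet (Set.univ.pi s) := MeasurableSet.univ_pi hs
  have hind : ∀ x : Fin k → ℝ, (Set.univ.pi s).indicator (fun x => ∏ i, gaussianPDFReal 0 1 (x i)) x
      = ∏ i, (s i).indicator (gaussianPDFReal 0 1) (x i) := by
    intro x
    by_cases hx : x ∈ Set.univ.pi s
    · rw [Set.indicator_of_mem hx]
      exact Finset.prod_congr rfl fun i _ => by rw [Set.indicator_of_mem (hx i trivial)]
    · rw [Set.indicator_of_notMem hx]
      simp only [Set.mem_pi, Set.mem_univ, true_implies, not_forall] at hx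
      obtain ⟨i, hi⟩ := hx
      exact (Finset.prod_eq_zero (Finset.mem_univ i) (Set.indicator_of_notMem hi _)).symm
  have hint : Integrable (fun x : Fin k → ℝ => ∏ i, gaussianPDFReal 0 1 (x i)) :=
    Integrable.fintype_prod fun _ => integrable_gaussianPDFReal 0 1
  rw [withDensity_apply _ hpi, ← ofReal_integral_eq_lintegral_ofReal hint.integrableOn
    (Filter.Eventually.of_forall fun x => Finset.prod_nonneg fun i _ => gaussianPDFReal_nonneg 0 1 _),
    ← integral_indicator hpi]
  simp_rw [hind]
  rw [integral_fintype_prod_volume_eq_prod (fun i => (s i).indicator (gaussianPDFReal 0 1)),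
    ENNReal.ofReal_prod_of_nonneg]
  · refine Finset.prod_congr rfl fun i _ => ?_
    rw [gaussianReal_apply_eq_integral _ one_ne_zero, integral_indicator (hs i)]
  · intro i _
    exact integral_nonneg fun x => Set.indicator_nonneg (fun _ _ => gaussianPDFReal_nonneg 0 1 _) _

theorem trunc_transfer (k : ℕ) (A : Set (Fin k → ℝ)) (hA : MeasurableSet A) :
    stdGaussian k A = ((volume : Measure (EuclideanSpace ℝ (Fin k))).withDensity
      (fun x => (fun r : ℝ => ENNReal.ofReal ((√(2 * Real.pi))⁻¹ ^ k * Real.exp (-r ^ 2 / 2))) ‖x‖))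
      ((fun x : EuclideanSpace ℝ (Fin k) => x.ofLp) ⁻¹' A) := by
  have hmp := PiLp.volume_preserving_ofLp (Fin k)
  have hA' : MeasurableSet ((fun x : EuclideanSpace ℝ (Fin k) => x.ofLp) ⁻¹' A) :=
    hmp.measurable hA
  have hm : Measurable (fun x : Fin k → ℝ => ENNReal.ofReal (∏ i, gaussianPDFReal 0 1 (x i))) := by
    refine Measurable.ennreal_ofReal (Finset.measurable_fun_prod _ fun i _ => ?_)
    exact (measurable_gaussianPDFReal 0 1).comp (measurable_pi_apply i)
  rw [_root_.stdGaussian, trunc_pi_density, withDensity_apply _ hA, withDensity_apply _ hA',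
    ← hmp.setLIntegral_comp_preimage hA hm]
  refine lintegral_congr fun x => ?_
  congr 1
  simp only [gaussianPDFReal_def, Finset.prod_mul_distrib, ← Real.exp_sum, EuclideanSpace.norm_sq_eq]
  simp [← Finset.sum_div]

/-- the truncated Gaussian `ζ_{k,d}` is more peaked than the standard
Gaussian `D`: for every symmetric convex (measurable) set `K ⊆ ℝ^k`,
`P(ζ_{k,d} ∈ K) ≥ P(D ∈ K)`. -/
theorem truncGaussian_morePeaked (k : ℕ) (d : ℝ) (hd : 0 < d)
    (K : Set (Fin k → ℝ)) (hK : MeasurableSet K) (hconv : Convex ℝ K) (hsymm : K = -K) :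
    stdGaussian k K ≤ truncGaussian k d K := by
  rcases K.eq_empty_or_nonempty with rfl | ⟨x, hx⟩
  · simp
  have h0 : (0 : Fin k → ℝ) ∈ K := by
    have hx' : -x ∈ K := by rw [hsymm]; simpa using hx
    have := hconv hx hx' (a := 1/2) (b := 1/2) (by norm_num) (by norm_num) (by norm_num)
    simpa using this
  have hprob : IsProbabilityMeasure (stdGaussian k) := by
    unfold _root_.stdGaussian; infer_instance
  have hBm : MeasurableSet {x : Fin k → ℝ | ∑ i, (x i) ^ 2 ≤ d} :=
    measurableSet_le (by fun_prop) measurable_const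
  have key : stdGaussian k {x | ∑ i, (x i) ^ 2 ≤ d} * stdGaussian k K ≤
      stdGaussian k ({x | ∑ i, (x i) ^ 2 ≤ d} ∩ K) := by
    rcases Nat.eq_zero_or_pos k with rfl | hk
    · have : K = Set.univ := Set.eq_univ_of_forall fun y => by
        rw [Subsingleton.elim y 0]; exact h0
      simp [this]
    have : Nonempty (Fin k) := ⟨⟨0, hk⟩⟩
    have hpre : (fun x : EuclideanSpace ℝ (Fin k) => x.ofLp) ⁻¹' {x | ∑ i, (x i) ^ 2 ≤ d} =
        Metric.closedBall 0 (√d) := by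
      ext y
      simp only [Set.mem_preimage, Set.mem_ofPred_eq, mem_closedBall_zero_iff]
      rw [Real.le_sqrt (norm_nonneg _) hd.le, EuclideanSpace.norm_sq_eq]
      simp
    have hu := trunc_transfer k Set.univ MeasurableSet.univ
    rw [measure_univ, Set.preimage_univ] at hu
    have hp := IsProbabilityMeasure.mk hu.symm
    rw [trunc_transfer k _ hBm, trunc_transfer k _ hK, trunc_transfer k _ (hBm.inter hK),
      Set.preimage_inter, hpre]
    refine trunc_core volume (fun r : ℝ => ENNReal.ofReal ((√(2 * Real.pi))⁻¹ ^ k * Real.exp (-r ^ 2 / 2)))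
      (by fun_prop) ((fun x : EuclideanSpace ℝ (Fin k) => x.ofLp) ⁻¹' K)
      ((PiLp.volume_preserving_ofLp (Fin k)).measurable hK) ?_ (√d)
    intro y hy t ht0 ht1
    exact hconv.smul_mem_of_zero_mem h0 hy ⟨ht0, ht1⟩
  rw [truncGaussian, cond_apply hBm]
  have hne : stdGaussian k {x | ∑ i, (x i) ^ 2 ≤ d} ≠ 0 := by
    have hg : (gaussianReal 0 1).IsOpenPosMeasure :=
      (gaussianReal_absolutelyContinuous' 0 one_ne_zero).isOpenPosMeasure
    have ho : (stdGaussian k).IsOpenPosMeasure := by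
      unfold _root_.stdGaussian; infer_instance
    have hU : IsOpen {x : Fin k → ℝ | ∑ i, (x i) ^ 2 < d} :=
      isOpen_lt (by fun_prop) continuous_const
    have h1 := hU.measure_pos (stdGaussian k) ⟨0, by simpa using hd⟩
    exact (h1.trans_le (measure_mono fun x (hx : _ < d) => le_of_lt hx)).ne'
  rw [mul_comm] at key
  calc stdGaussian k K ≤ stdGaussian k ({x | ∑ i, (x i) ^ 2 ≤ d} ∩ K) / stdGaussian k {x | ∑ i, (x i) ^ 2 ≤ d} :=
        (ENNReal.le_div_iff_mul_le (Or.inl hne) (Or.inl (measure_ne_top _ _))).2 key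
    _ = _ := by rw [ENNReal.div_eq_inv_mul]
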